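/- arXiv:1406.2661 — 3 statements merged into one kernel-verified Lean document; each statement's English description precedes it below -/
import Mathlib

section
/- (Proposition 1, optimal discriminator.) Let (X, μ) be a measure space and let p, q : X → ℝ≥0 be measurable probability density functions with respect to μ (i.e., ∫ p dμ = ∫ q dμ = 1). For every measurable function D : X → [0,1], the value V(D) = ∫ p(x)·log(D(x)) dμ(x) + ∫ q(x)·log(1−D(x)) dμ(x) satisfies V(D) ≤ V(D*), where D*(x) = p(x)/(p(x)+q(x)) on the set where p(x)+q(x) > 0 (and D* is defined arbitrarily, e.g. as 1/2, elsewhere). That is, D* maximizes V over all measurable discriminators taking values in [0,1]. -/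
open MeasureTheory
open scoped NNReal ENNReal

/-- Truncation of an extended real to `ℝ≥0∞` (negatives and `⊥` map to `0`). -/
noncomputable def erealToENNReal (x : EReal) : ℝ≥0∞ :=
  if x = ⊤ then ⊤ else ENNReal.ofReal x.toReal

/-- Integral of an extended-real-valued function, defined via the positive and
negative parts, with values in the extended reals. -/
noncomputable def eIntegral {X : Type*} [MeasurableSpace X] (μ : Measure X)
    (f : X → EReal) : EReal :=
  ((∫⁻ x, erealToENNReal (f x) ∂μ : ℝ≥0∞) : EReal)
    - ((∫⁻ x, erealToENNReal (-(f x)) ∂μ : ℝ≥0∞) : EReal)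

/-- The GAN value function `V(D) = ∫ p·log D dμ + ∫ q·log (1 - D) dμ`, with the
conventions `log 0 = -∞` and `0·(-∞) = 0` (via `ENNReal.log` and `EReal` arithmetic). -/
noncomputable def V {X : Type*} [MeasurableSpace X] (μ : Measure X)
    (p q : X → ℝ≥0) (D : X → ℝ) : EReal :=
  eIntegral μ (fun x => ((p x : ℝ≥0∞) : EReal) * ENNReal.log (ENNReal.ofReal (D x)))
    + eIntegral μ (fun x => ((q x : ℝ≥0∞) : EReal) * ENNReal.log (ENNReal.ofReal (1 - D x)))

/-- The optimal discriminator `D*(x) = p(x)/(p(x)+q(x))` on `{p+q > 0}`, set to `1/2`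
elsewhere. -/
noncomputable def Dstar {X : Type*} (p q : X → ℝ≥0) (x : X) : ℝ :=
  if p x + q x = 0 then 1 / 2 else (p x : ℝ) / ((p x : ℝ) + (q x : ℝ))

/-- The GAN criterion `C(p,q) = ∫ p·log (p/(p+q)) dμ + ∫ q·log (q/(p+q)) dμ`. -/
noncomputable def Cval {X : Type*} [MeasurableSpace X] (μ : Measure X)
    (p q : X → ℝ≥0) : EReal :=
  eIntegral μ (fun x =>
      ((p x : ℝ≥0∞) : EReal) * ENNReal.log ((p x : ℝ≥0∞) / ((p x : ℝ≥0∞) + (q x : ℝ≥0∞))))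
    + eIntegral μ (fun x =>
      ((q x : ℝ≥0∞) : EReal) * ENNReal.log ((q x : ℝ≥0∞) / ((p x : ℝ≥0∞) + (q x : ℝ≥0∞))))

/-- The Kullback--Leibler divergence `KL(f ‖ g) = ∫ f·log (f/g) dμ` between densities,
with the conventions `0·log (0/g) = 0` and `f·log (f/0) = +∞` for `f > 0`. -/
noncomputable def klDiv {X : Type*} [MeasurableSpace X] (μ : Measure X)
    (f g : X → ℝ≥0) : EReal :=
  eIntegral μ (fun x => ((f x : ℝ≥0∞) : EReal) * ENNReal.log ((f x : ℝ≥0∞) / (g x : ℝ≥0∞)))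


/-- On `[0, 1]`, the negative part of the integrand `a * log t`. -/
lemma erealToENNReal_neg_mul_log (a : ℝ≥0) {t : ℝ} (ht : t ∈ Set.Icc (0 : ℝ) 1) :
    erealToENNReal (-(((a : ℝ≥0∞) : EReal) * ENNReal.log (ENNReal.ofReal t))) =
      if a = 0 then 0 else if t = 0 then ⊤ else ENNReal.ofReal (-((a : ℝ) * Real.log t)) := by
  have ha' : ((a : ℝ≥0∞) : EReal) = ((a : ℝ) : EReal) := rfl
  rw [ha']
  split_ifs with ha h
  · simp [ha, erealToENNReal]
  · have hpos : (0 : ℝ) < a := by positivity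
    simp [h, erealToENNReal, EReal.coe_mul_bot_of_pos hpos]
  · rw [ENNReal.log_ofReal_of_pos (lt_of_le_of_ne ht.1 (Ne.symm h)), ← EReal.coe_mul,
      ← EReal.coe_neg, erealToENNReal, if_neg (EReal.coe_ne_top _), EReal.toReal_coe]

/-- On `[0, 1]`, the integrand `a * log t` has no positive part. -/
lemma erealToENNReal_mul_log (a : ℝ≥0) {t : ℝ} (ht : t ∈ Set.Icc (0 : ℝ) 1) :
    erealToENNReal (((a : ℝ≥0∞) : EReal) * ENNReal.log (ENNReal.ofReal t)) = 0 := by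
  have hle : ((a : ℝ≥0∞) : EReal) * ENNReal.log (ENNReal.ofReal t) ≤ 0 := by
    refine mul_nonpos_of_nonneg_of_nonpos (EReal.coe_ennreal_nonneg _) ?_
    rw [← ENNReal.log_one, ENNReal.log_le_log_iff]
    exact ENNReal.ofReal_le_one.2 ht.2
  rw [erealToENNReal, if_neg (hle.trans_lt EReal.zero_lt_top).ne]
  exact ENNReal.ofReal_of_nonpos (EReal.toReal_nonpos hle)

lemma eIntegral_mul_log {X : Type*} [MeasurableSpace X] (μ : Measure X) (p : X → ℝ≥0)
    {D : X → ℝ} (hD : ∀ x, D x ∈ Set.Icc (0 : ℝ) 1) :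
    eIntegral μ (fun x => ((p x : ℝ≥0∞) : EReal) * ENNReal.log (ENNReal.ofReal (D x))) =
      -((∫⁻ x, erealToENNReal
        (-(((p x : ℝ≥0∞) : EReal) * ENNReal.log (ENNReal.ofReal (D x)))) ∂μ : ℝ≥0∞) : EReal) := by
  simp only [eIntegral, erealToENNReal_mul_log _ (hD _)]
  simp

lemma V_eq_neg_add {X : Type*} [MeasurableSpace X] (μ : Measure X) (p q : X → ℝ≥0)
    {D : X → ℝ} (hD : ∀ x, D x ∈ Set.Icc (0 : ℝ) 1) :
    V μ p q D = -((∫⁻ x, erealToENNReal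
          (-(((p x : ℝ≥0∞) : EReal) * ENNReal.log (ENNReal.ofReal (D x)))) ∂μ +
        ∫⁻ x, erealToENNReal
          (-(((q x : ℝ≥0∞) : EReal) * ENNReal.log (ENNReal.ofReal (1 - D x)))) ∂μ : ℝ≥0∞) :
        EReal) := by
  have hD' : ∀ x, 1 - D x ∈ Set.Icc (0 : ℝ) 1 := fun x =>
    ⟨by linarith [(hD x).2], by linarith [(hD x).1]⟩
  rw [V, eIntegral_mul_log μ p hD, eIntegral_mul_log μ q hD', EReal.coe_ennreal_add,
    EReal.neg_add (Or.inl (EReal.coe_ennreal_ne_bot _)) (Or.inr (EReal.coe_ennreal_ne_bot _)),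
    sub_eq_add_neg]

lemma measurable_erealToENNReal_neg_mul_log {X : Type*} [MeasurableSpace X] {p : X → ℝ≥0}
    (hp : Measurable p) {D : X → ℝ} (hDm : Measurable D) (hD : ∀ x, D x ∈ Set.Icc (0 : ℝ) 1) :
    Measurable fun x => erealToENNReal
      (-(((p x : ℝ≥0∞) : EReal) * ENNReal.log (ENNReal.ofReal (D x)))) := by
  simp only [erealToENNReal_neg_mul_log _ (hD _)]
  refine Measurable.ite (hp (measurableSet_singleton 0)) measurable_const
    (Measurable.ite (hDm (measurableSet_singleton 0)) measurable_const ?_)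
  fun_prop

lemma Dstar_mem_Icc {X : Type*} (p q : X → ℝ≥0) (x : X) :
    Dstar p q x ∈ Set.Icc (0 : ℝ) 1 := by
  unfold Dstar
  split_ifs
  · norm_num
  · exact ⟨by positivity, div_le_one_of_le₀ (by simp) (by positivity)⟩

/-- Gibbs' inequality on a two-point space. -/
lemma mul_log_add_mul_log_one_sub_le {a b t : ℝ} (ha : 0 < a) (hb : 0 < b) (ht0 : 0 < t)
    (ht1 : t < 1) :
    a * Real.log t + b * Real.log (1 - t) ≤
      a * Real.log (a / (a + b)) + b * Real.log (1 - a / (a + b)) := by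
  have hab : 1 - a / (a + b) = b / (a + b) := by field_simp; ring
  have key : ∀ c s : ℝ, 0 < c → 0 < s →
      c * Real.log s - c * Real.log (c / (a + b)) ≤ (a + b) * s - c := by
    intro c s hc hs
    have h := Real.log_le_sub_one_of_pos (x := s / (c / (a + b))) (by positivity)
    rw [Real.log_div hs.ne' (by positivity)] at h
    calc c * Real.log s - c * Real.log (c / (a + b))
        = c * (Real.log s - Real.log (c / (a + b))) := by ring
      _ ≤ c * (s / (c / (a + b)) - 1) := by gcongr
      _ = (a + b) * s - c := by field_simp
  rw [hab]
  linarith [key a t ha ht0, key b (1 - t) hb (by linarith)]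

/-- `Dstar` minimises the pointwise cross-entropy. -/
lemma erealToENNReal_Dstar_le {X : Type*} (p q : X → ℝ≥0) (x : X) {t : ℝ}
    (ht : t ∈ Set.Icc (0 : ℝ) 1) :
    erealToENNReal (-(((p x : ℝ≥0∞) : EReal) * ENNReal.log (ENNReal.ofReal (Dstar p q x)))) +
        erealToENNReal
          (-(((q x : ℝ≥0∞) : EReal) * ENNReal.log (ENNReal.ofReal (1 - Dstar p q x)))) ≤
      erealToENNReal (-(((p x : ℝ≥0∞) : EReal) * ENNReal.log (ENNReal.ofReal t))) +
        erealToENNReal (-(((q x : ℝ≥0∞) : EReal) * ENNReal.log (ENNReal.ofReal (1 - t)))) := by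
  have compl {s : ℝ} (hs : s ∈ Set.Icc (0 : ℝ) 1) : 1 - s ∈ Set.Icc (0 : ℝ) 1 :=
    ⟨by linarith [hs.2], by linarith [hs.1]⟩
  have hs := Dstar_mem_Icc p q x
  rw [erealToENNReal_neg_mul_log _ hs, erealToENNReal_neg_mul_log _ (compl hs),
    erealToENNReal_neg_mul_log _ ht, erealToENNReal_neg_mul_log _ (compl ht)]
  by_cases hp : p x = 0
  · by_cases hq : q x = 0 <;> simp [hp, hq, Dstar]
  by_cases hq : q x = 0
  · simp [hp, hq, Dstar]
  by_cases h0 : t = 0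
  · simp [hp, h0]
  by_cases h1 : 1 - t = 0
  · simp [hq, h1]
  have hp' : (0 : ℝ) < p x := by positivity
  have hq' : (0 : ℝ) < q x := by positivity
  have hD : Dstar p q x = (p x : ℝ) / (p x + q x) := by simp [Dstar, hp]
  have hD0 : Dstar p q x ≠ 0 := by rw [hD]; positivity
  have hD1 : 1 - Dstar p q x ≠ 0 := by
    rw [hD, one_sub_div (by positivity), add_sub_cancel_left]; positivity
  simp only [hp, hq, h0, h1, hD0, hD1, if_false]
  have neg_nonneg_mul_log {a s : ℝ} (ha : 0 < a) (hs : s ∈ Set.Icc (0 : ℝ) 1) :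
      0 ≤ -(a * Real.log s) :=
    neg_nonneg.2 (mul_nonpos_of_nonneg_of_nonpos ha.le (Real.log_nonpos hs.1 hs.2))
  rw [← ENNReal.ofReal_add (neg_nonneg_mul_log hp' hs) (neg_nonneg_mul_log hq' (compl hs)),
    ← ENNReal.ofReal_add (neg_nonneg_mul_log hp' ht) (neg_nonneg_mul_log hq' (compl ht))]
  refine ENNReal.ofReal_le_ofReal ?_
  rw [hD]
  linarith [mul_log_add_mul_log_one_sub_le hp' hq' (lt_of_le_of_ne ht.1 (Ne.symm h0))
    (sub_pos.1 (lt_of_le_of_ne (compl ht).1 (Ne.symm h1)))]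

/-- **Proposition 1 (optimal discriminator).** For densities `p, q` with respect to `μ`,
and any measurable discriminator `D : X → [0,1]`,
`V(D) ≤ V(D*)` where `D* = p/(p+q)` on `{p+q > 0}` (and `1/2` elsewhere). -/
theorem optimal_discriminator {X : Type*} [MeasurableSpace X] (μ : Measure X)
    (p q : X → ℝ≥0) (hp : Measurable p) (hq : Measurable q)
    (hp1 : ∫⁻ x, (p x : ℝ≥0∞) ∂μ = 1) (hq1 : ∫⁻ x, (q x : ℝ≥0∞) ∂μ = 1)
    (D : X → ℝ) (hD : Measurable D) (hD01 : ∀ x, D x ∈ Set.Icc (0 : ℝ) 1) :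
    V μ p q D ≤ V μ p q (Dstar p q) := by
  rw [V_eq_neg_add μ p q hD01, V_eq_neg_add μ p q (Dstar_mem_Icc p q), EReal.neg_le_neg_iff,
    EReal.coe_ennreal_le_coe_ennreal_iff,
    ← lintegral_add_left (measurable_erealToENNReal_neg_mul_log hp hD hD01)]
  exact (le_lintegral_add _ _).trans
    (lintegral_mono fun x => erealToENNReal_Dstar_le p q x (hD01 x))
end

section
/- Let (X, μ) be a measure space and let p, q : X → ℝ≥0 be measurable probability density functions with respect to μ. Then the supremum over all measurable D : X → [0,1] of V(D) = ∫ p·log D dμ + ∫ q·log(1−D) dμ equals C(p,q) = ∫ p(x)·log( p(x)/(p(x)+q(x)) ) dμ(x) + ∫ q(x)·log( q(x)/(p(x)+q(x)) ) dμ(x). -/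
open MeasureTheory
open scoped NNReal ENNReal

/-- The pointwise loss `-(a·log d)`, truncated to `ℝ≥0∞`. -/
noncomputable def logLoss (a : ℝ≥0) (d : ℝ) : ℝ≥0∞ :=
  erealToENNReal (-(((a : ℝ≥0∞) : EReal) * ENNReal.log (ENNReal.ofReal d)))

lemma coe_mul_log_ofReal (a : ℝ≥0) {d : ℝ} (hd : 0 < d) :
    ((a : ℝ≥0∞) : EReal) * ENNReal.log (ENNReal.ofReal d) = ((a * Real.log d : ℝ) : EReal) := by
  rw [ENNReal.log_ofReal_of_pos hd, EReal.coe_mul]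
  rfl

lemma logLoss_zero_left (d : ℝ) : logLoss 0 d = 0 := by
  simp [logLoss, erealToENNReal]

lemma logLoss_of_pos (a : ℝ≥0) {d : ℝ} (hd : 0 < d) :
    logLoss a d = ENNReal.ofReal (-(a * Real.log d)) := by
  rw [logLoss, coe_mul_log_ofReal a hd, ← EReal.coe_neg, erealToENNReal,
    if_neg (EReal.coe_ne_top _), EReal.toReal_coe]

lemma logLoss_of_nonpos {a : ℝ≥0} (ha : a ≠ 0) {d : ℝ} (hd : d ≤ 0) : logLoss a d = ⊤ := by
  have ha' : (0 : EReal) < ((a : ℝ≥0∞) : EReal) := by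
    exact_mod_cast pos_iff_ne_zero.mpr ha
  rw [logLoss, ENNReal.ofReal_of_nonpos hd, ENNReal.log_zero, EReal.mul_bot_of_pos ha']
  simp [erealToENNReal]

lemma measurable_logLoss {X : Type*} [MeasurableSpace X] {a : X → ℝ≥0} {d : X → ℝ}
    (ha : Measurable a) (hd : Measurable d) : Measurable fun x => logLoss (a x) (d x) := by
  have h : (fun x => logLoss (a x) (d x)) = fun x => if a x = 0 then 0 else
      if d x ≤ 0 then ⊤ else ENNReal.ofReal (-(a x * Real.log (d x))) := by
    funext x
    split_ifs with h1 h2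
    · rw [h1, logLoss_zero_left]
    · exact logLoss_of_nonpos h1 h2
    · exact logLoss_of_pos _ (not_le.mp h2)
  rw [h]
  refine Measurable.ite (ha (measurableSet_singleton 0)) measurable_const
    (Measurable.ite (measurableSet_le hd measurable_const) measurable_const ?_)
  fun_prop

lemma eIntegral_coe_mul_log {X : Type*} [MeasurableSpace X] (μ : Measure X) (a : X → ℝ≥0)
    {d : X → ℝ} (hd : ∀ x, d x ≤ 1) :
    eIntegral μ (fun x => ((a x : ℝ≥0∞) : EReal) * ENNReal.log (ENNReal.ofReal (d x)))
      = -((∫⁻ x, logLoss (a x) (d x) ∂μ : ℝ≥0∞) : EReal) := by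
  have h (x : X) :
      erealToENNReal (((a x : ℝ≥0∞) : EReal) * ENNReal.log (ENNReal.ofReal (d x))) = 0 := by
    have hle : ((a x : ℝ≥0∞) : EReal) * ENNReal.log (ENNReal.ofReal (d x)) ≤ 0 := by
      refine mul_nonpos_of_nonneg_of_nonpos (EReal.coe_ennreal_nonneg _) ?_
      simpa using ENNReal.log_monotone (ENNReal.ofReal_le_one.mpr (hd x))
    rw [erealToENNReal, if_neg (ne_top_of_le_ne_top EReal.zero_ne_top hle),
      ENNReal.ofReal_of_nonpos (EReal.toReal_nonpos hle)]
  simp only [eIntegral, h, logLoss, lintegral_zero, EReal.coe_ennreal_zero, zero_sub]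

lemma V_eq_neg_lintegral {X : Type*} [MeasurableSpace X] (μ : Measure X)
    {p : X → ℝ≥0} (q : X → ℝ≥0) (hp : Measurable p) {D : X → ℝ} (hD : Measurable D)
    (h01 : ∀ x, D x ∈ Set.Icc (0 : ℝ) 1) :
    V μ p q D
      = -((∫⁻ x, logLoss (p x) (D x) + logLoss (q x) (1 - D x) ∂μ : ℝ≥0∞) : EReal) := by
  rw [lintegral_add_left (measurable_logLoss hp hD), EReal.coe_ennreal_add, V,
    eIntegral_coe_mul_log μ p fun x => (h01 x).2,
    eIntegral_coe_mul_log μ q fun x => sub_le_self _ (h01 x).1,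
    EReal.neg_add (.inl (EReal.coe_ennreal_ne_bot _)) (.inr (EReal.coe_ennreal_ne_bot _)),
    sub_eq_add_neg]

/-- Gibbs' inequality for two outcomes. -/
lemma mul_log_add_mul_log_le {a b d : ℝ} (ha : 0 < a) (hb : 0 < b) (hd : 0 < d) (hd1 : d < 1) :
    a * Real.log d + b * Real.log (1 - d)
      ≤ a * Real.log (a / (a + b)) + b * Real.log (b / (a + b)) := by
  have key {c t : ℝ} (hc : 0 < c) (ht : 0 < t) :
      c * Real.log t - c * Real.log (c / (a + b)) ≤ t * (a + b) - c := by
    have hs : 0 < a + b := add_pos ha hb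
    rw [← mul_sub, ← Real.log_div ht.ne' (div_pos hc hs).ne']
    refine (mul_le_mul_of_nonneg_left (Real.log_le_sub_one_of_pos
      (div_pos ht (div_pos hc hs))) hc.le).trans_eq ?_
    field_simp
  linarith [key ha hd, key hb (sub_pos.mpr hd1)]

lemma measurable_Dstar {X : Type*} [MeasurableSpace X] {p q : X → ℝ≥0} (hp : Measurable p)
    (hq : Measurable q) : Measurable (Dstar p q) := by
  unfold Dstar
  exact Measurable.ite ((hp.add hq) (measurableSet_singleton 0)) measurable_const (by fun_prop)

lemma one_sub_Dstar {X : Type*} {p q : X → ℝ≥0} {x : X} (h : p x + q x ≠ 0) :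
    1 - Dstar p q x = q x / ((p x : ℝ) + q x) := by
  have h' : (p x : ℝ) + q x ≠ 0 := mod_cast h
  rw [Dstar, if_neg h]
  field_simp
  ring

lemma logLoss_Dstar_le {X : Type*} (p q : X → ℝ≥0) (x : X) {d : ℝ} :
    logLoss (p x) (Dstar p q x) + logLoss (q x) (1 - Dstar p q x)
      ≤ logLoss (p x) d + logLoss (q x) (1 - d) := by
  rcases eq_or_ne (p x) 0 with hp | hp <;> rcases eq_or_ne (q x) 0 with hq | hq
  · simp [hp, hq, logLoss_zero_left]
  · have hD : Dstar p q x = 0 := by simp [Dstar, hp, hq]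
    simp [hp, hD, logLoss_zero_left, logLoss_of_pos]
  · have hD : Dstar p q x = 1 := by simp [Dstar, hp, hq]
    simp [hq, hD, logLoss_zero_left, logLoss_of_pos]
  rcases le_or_gt d 0 with hd | hd
  · simp [logLoss_of_nonpos hp hd]
  rcases le_or_gt 1 d with hd1 | hd1
  · simp [logLoss_of_nonpos hq (sub_nonpos.mpr hd1)]
  have hp' : (0 : ℝ) < p x := mod_cast pos_iff_ne_zero.mpr hp
  have hq' : (0 : ℝ) < q x := mod_cast pos_iff_ne_zero.mpr hq
  have hs : p x + q x ≠ 0 := by simp [hp]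
  have nonneg {a t : ℝ} (ha : 0 < a) (ht : 0 < t) (ht1 : t ≤ 1) : 0 ≤ -(a * Real.log t) :=
    neg_nonneg.mpr (mul_nonpos_of_nonneg_of_nonpos ha.le (Real.log_nonpos ht.le ht1))
  have hsp : (p x : ℝ) / (p x + q x) ≤ 1 := div_le_one_of_le₀ (by simp) (by positivity)
  have hsq : (q x : ℝ) / (p x + q x) ≤ 1 := div_le_one_of_le₀ (by simp) (by positivity)
  rw [one_sub_Dstar hs, Dstar, if_neg hs, logLoss_of_pos _ (by positivity),
    logLoss_of_pos _ (by positivity), logLoss_of_pos _ hd, logLoss_of_pos _ (sub_pos.mpr hd1),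
    ← ENNReal.ofReal_add (nonneg hp' (by positivity) hsp) (nonneg hq' (by positivity) hsq),
    ← ENNReal.ofReal_add (nonneg hp' hd hd1.le) (nonneg hq' (sub_pos.mpr hd1) (by linarith))]
  exact ENNReal.ofReal_le_ofReal (by linarith [mul_log_add_mul_log_le hp' hq' hd hd1])

lemma Cval_eq_V_Dstar {X : Type*} [MeasurableSpace X] (μ : Measure X) (p q : X → ℝ≥0) :
    Cval μ p q = V μ p q (Dstar p q) := by
  have ratio (a : ℝ≥0) {x : X} (h : p x + q x ≠ 0) :
      ENNReal.ofReal (a / ((p x : ℝ) + q x)) = (a : ℝ≥0∞) / ((p x : ℝ≥0∞) + q x) := by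
    have h' : (0 : ℝ) < (p x : ℝ) + q x := mod_cast pos_iff_ne_zero.mpr h
    rw [ENNReal.ofReal_div_of_pos h', ENNReal.ofReal_add (p x).coe_nonneg (q x).coe_nonneg]
    simp
  unfold Cval V
  congr 2 <;> funext x <;> by_cases h : p x + q x = 0
  · simp [(add_eq_zero.mp h).1]
  · rw [Dstar, if_neg h, ratio _ h]
  · simp [(add_eq_zero.mp h).2]
  · rw [one_sub_Dstar h, ratio _ h]

/-- The supremum of `V(D)` over all measurable discriminators `D : X → [0,1]` equals
`C(p,q) = ∫ p·log (p/(p+q)) dμ + ∫ q·log (q/(p+q)) dμ`. -/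
theorem iSup_value_eq_criterion {X : Type*} [MeasurableSpace X] (μ : Measure X)
    (p q : X → ℝ≥0) (hp : Measurable p) (hq : Measurable q)
    (hp1 : ∫⁻ x, (p x : ℝ≥0∞) ∂μ = 1) (hq1 : ∫⁻ x, (q x : ℝ≥0∞) ∂μ = 1) :
    (⨆ D : {D : X → ℝ // Measurable D ∧ ∀ x, D x ∈ Set.Icc (0 : ℝ) 1}, V μ p q D.1)
      = Cval μ p q := by
  rw [Cval_eq_V_Dstar]
  have hD := measurable_Dstar hp hq
  refine le_antisymm (iSup_le fun D => ?_)
    (le_iSup_of_le ⟨Dstar p q, hD, Dstar_mem_Icc p q⟩ le_rfl)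
  rw [V_eq_neg_lintegral μ q hp D.2.1 D.2.2, V_eq_neg_lintegral μ q hp hD (Dstar_mem_Icc p q),
    EReal.neg_le_neg_iff, EReal.coe_ennreal_le_coe_ennreal_iff]
  exact lintegral_mono fun x => logLoss_Dstar_le p q x
end

section
/- (KL decomposition of the GAN criterion.) Let (X, μ) be a measure space and let p, q : X → ℝ≥0 be measurable probability density functions with respect to μ. Then ∫ p(x)·log( p(x)/(p(x)+q(x)) ) dμ(x) + ∫ q(x)·log( q(x)/(p(x)+q(x)) ) dμ(x) = −log 4 + KL( p ‖ (p+q)/2 ) + KL( q ‖ (p+q)/2 ), where KL(f ‖ g) = ∫ f(x)·log( f(x)/g(x) ) dμ(x) denotes the Kullback–Leibler divergence between the probability densities f and g (note that (p+q)/2 is again a probability density with respect to μ). -/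
open MeasureTheory
open scoped NNReal ENNReal

theorem eIntegral_coe_real {X : Type*} [MeasurableSpace X] {μ : Measure X} {f : X → ℝ}
    (hf : Integrable f μ) :
    eIntegral μ (fun x => (f x : EReal)) = ((∫ x, f x ∂μ : ℝ) : EReal) := by
  have hpos : ∫⁻ x, ENNReal.ofReal (f x) ∂μ ≠ ⊤ := hf.lintegral_lt_top.ne
  have hneg : ∫⁻ x, ENNReal.ofReal (-f x) ∂μ ≠ ⊤ := hf.neg.lintegral_lt_top.ne
  have htrunc : ∀ r : ℝ, erealToENNReal (r : EReal) = ENNReal.ofReal r := fun r => by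
    simp [erealToENNReal]
  rw [integral_eq_lintegral_pos_part_sub_lintegral_neg_part hf, EReal.coe_sub,
    EReal.coe_ennreal_toReal hpos, EReal.coe_ennreal_toReal hneg]
  simp only [eIntegral, ← EReal.coe_neg, htrunc]

theorem coe_mul_log_div_eq_coe_real {a b : ℝ≥0} (h : b = 0 → a = 0) :
    ((a : ℝ≥0∞) : EReal) * ENNReal.log ((a : ℝ≥0∞) / (b : ℝ≥0∞))
      = (((a : ℝ) * Real.log ((a : ℝ) / (b : ℝ)) : ℝ) : EReal) := by
  rcases eq_or_ne a 0 with rfl | ha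
  · simp
  have hb : b ≠ 0 := fun hb => ha (h hb)
  have hab : ((a / b : ℝ≥0) : ℝ≥0∞) ≠ 0 := by
    simpa using ⟨ha, hb⟩
  rw [← ENNReal.coe_div hb, ENNReal.log_pos_real hab ENNReal.coe_ne_top, EReal.coe_mul]
  simp
  rfl

theorem abs_mul_log_div_add_le {a b : ℝ} (ha : 0 ≤ a) (hb : 0 ≤ b) :
    |a * Real.log (a / (a + b))| ≤ b := by
  rcases ha.eq_or_lt with rfl | ha
  · simpa using hb
  have hlog : Real.log (a / (a + b)) ≤ 0 :=
    Real.log_nonpos (by positivity) (div_le_one_of_le₀ (by linarith) (by positivity))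
  have hinv : -Real.log (a / (a + b)) ≤ (a + b) / a - 1 := by
    rw [← Real.log_inv, inv_div]
    exact Real.log_le_sub_one_of_pos (by positivity)
  rw [abs_of_nonpos (mul_nonpos_of_nonneg_of_nonpos ha.le hlog)]
  calc -(a * Real.log (a / (a + b))) = a * -Real.log (a / (a + b)) := by ring
    _ ≤ a * ((a + b) / a - 1) := by gcongr
    _ = b := by field_simp; ring

theorem integrable_coe_of_lintegral_eq_one {X : Type*} [MeasurableSpace X] {μ : Measure X}
    {p : X → ℝ≥0} (hp : Measurable p) (hp1 : ∫⁻ x, (p x : ℝ≥0∞) ∂μ = 1) :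
    Integrable (fun x => (p x : ℝ)) μ :=
  ⟨hp.coe_nnreal_real.aestronglyMeasurable, by simp [HasFiniteIntegral, hp1]⟩

theorem integral_coe_of_lintegral_eq_one {X : Type*} [MeasurableSpace X] {μ : Measure X}
    {p : X → ℝ≥0} (hp : Measurable p) (hp1 : ∫⁻ x, (p x : ℝ≥0∞) ∂μ = 1) :
    ∫ x, (p x : ℝ) ∂μ = 1 := by
  rw [integral_eq_lintegral_of_nonneg_ae (.of_forall fun x => NNReal.coe_nonneg (p x))
    hp.coe_nnreal_real.aestronglyMeasurable]
  simp [hp1]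

theorem integrable_mul_log_div_add {X : Type*} [MeasurableSpace X] {μ : Measure X}
    {p q : X → ℝ≥0} (hp : Measurable p) (hq : Measurable q)
    (hq1 : ∫⁻ x, (q x : ℝ≥0∞) ∂μ = 1) :
    Integrable (fun x => (p x : ℝ) * Real.log ((p x : ℝ) / ((p x : ℝ) + (q x : ℝ)))) μ :=
  (integrable_coe_of_lintegral_eq_one hq hq1).mono'
    (by fun_prop) (.of_forall fun x => abs_mul_log_div_add_le (p x).2 (q x).2)

theorem eIntegral_mul_log_div_add {X : Type*} [MeasurableSpace X] {μ : Measure X}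
    {p q : X → ℝ≥0} (hp : Measurable p) (hq : Measurable q)
    (hq1 : ∫⁻ x, (q x : ℝ≥0∞) ∂μ = 1) :
    eIntegral μ (fun x => ((p x : ℝ≥0∞) : EReal) *
        ENNReal.log ((p x : ℝ≥0∞) / ((p x : ℝ≥0∞) + (q x : ℝ≥0∞))))
      = ((∫ x, (p x : ℝ) * Real.log ((p x : ℝ) / ((p x : ℝ) + (q x : ℝ))) ∂μ : ℝ) : EReal) := by
  rw [← eIntegral_coe_real (integrable_mul_log_div_add hp hq hq1)]
  congr 1
  funext x
  rw [← ENNReal.coe_add, coe_mul_log_div_eq_coe_real fun h => (add_eq_zero.mp h).1,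
    NNReal.coe_add]

theorem klDiv_midpoint {X : Type*} [MeasurableSpace X] {μ : Measure X}
    {p q : X → ℝ≥0} (hp : Measurable p) (hq : Measurable q)
    (hp1 : ∫⁻ x, (p x : ℝ≥0∞) ∂μ = 1) (hq1 : ∫⁻ x, (q x : ℝ≥0∞) ∂μ = 1) :
    klDiv μ p (fun x => (p x + q x) / 2)
      = ((∫ x, (p x : ℝ) * Real.log ((p x : ℝ) / ((p x : ℝ) + (q x : ℝ))) ∂μ
          + Real.log 2 : ℝ) : EReal) := by
  have hi := integrable_mul_log_div_add (μ := μ) hp hq hq1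
  have hc := (integrable_coe_of_lintegral_eq_one hp hp1).mul_const (Real.log 2)
  have hsum : ∫ x, (p x : ℝ) * Real.log ((p x : ℝ) / ((p x : ℝ) + (q x : ℝ))) ∂μ + Real.log 2
      = ∫ x, ((p x : ℝ) * Real.log ((p x : ℝ) / ((p x : ℝ) + (q x : ℝ)))
          + (p x : ℝ) * Real.log 2) ∂μ := by
    rw [integral_add hi hc, integral_mul_const, integral_coe_of_lintegral_eq_one hp hp1, one_mul]
  rw [hsum]
  refine Eq.trans ?_ (eIntegral_coe_real (hi.add hc))
  rw [klDiv]
  congr 1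
  funext x
  rw [coe_mul_log_div_eq_coe_real fun h => by simp_all]
  congr 1
  rcases eq_or_ne (p x) 0 with h0 | h0
  · simp [h0]
  have hpx : 0 < (p x : ℝ) := NNReal.coe_pos.mpr (pos_iff_ne_zero.mpr h0)
  have hqx : 0 ≤ (q x : ℝ) := (q x).2
  rw [← mul_add, ← Real.log_mul (by positivity) two_ne_zero]
  congr 2
  push_cast
  field_simp

/-- **KL decomposition of the GAN criterion.**
`C(p,q) = -log 4 + KL(p ‖ (p+q)/2) + KL(q ‖ (p+q)/2)`. -/
theorem criterion_eq_klDiv {X : Type*} [MeasurableSpace X] (μ : Measure X)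
    (p q : X → ℝ≥0) (hp : Measurable p) (hq : Measurable q)
    (hp1 : ∫⁻ x, (p x : ℝ≥0∞) ∂μ = 1) (hq1 : ∫⁻ x, (q x : ℝ≥0∞) ∂μ = 1) :
    Cval μ p q
      = ((-Real.log 4 : ℝ) : EReal)
        + klDiv μ p (fun x => (p x + q x) / 2)
        + klDiv μ q (fun x => (p x + q x) / 2) := by
  have hlog : Real.log 4 = 2 * Real.log 2 := by
    rw [show (4 : ℝ) = 2 ^ 2 by norm_num, Real.log_pow]
    norm_num
  have hq_kl := klDiv_midpoint hq hp hq1 hp1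
  have hq_int := eIntegral_mul_log_div_add hq hp hp1
  simp only [add_comm (q _ : ℝ≥0∞), add_comm (q _ : ℝ), add_comm (q _)] at hq_kl hq_int
  rw [Cval, eIntegral_mul_log_div_add hp hq hq1, hq_int, klDiv_midpoint hp hq hp1 hq1, hq_kl,
    ← EReal.coe_add, ← EReal.coe_add, ← EReal.coe_add, hlog]
  congr 1
  ring
end
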